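/- arXiv:2509.15024 — 3 statements merged into one kernel-verified Lean document; each statement's English description precedes it below -/
import Mathlib

section
/- For all a, b ∈ ℝ^C, the softmax map is 1-Lipschitz from the ℓ2 norm to the ℓ1 norm: Σ_{c=1}^{C} |softmax(a)_c − softmax(b)_c| ≤ ‖a − b‖_2, where softmax(z)_c = exp(z_c) / Σ_{k=1}^{C} exp(z_k). -/
/-- The softmax map: `softmax z c = exp (z c) / ∑ k, exp (z k)`. -/
noncomputable def softmax {C : ℕ} (z : Fin C → ℝ) : Fin C → ℝ :=
  fun c => Real.exp (z c) / ∑ k, Real.exp (z k)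

/-- The covariance of `s` and `d` under a probability vector `p` is at most the Euclidean norm of
`d` when `s` takes values in `[-1, 1]`. -/
theorem covariance_le_sqrt_sum_sq {ι : Type*} [Fintype ι] (p s d : ι → ℝ) (hp : ∀ i, 0 ≤ p i)
    (hsum : ∑ i, p i = 1) (hs : ∀ i, s i ^ 2 ≤ 1) :
    ∑ i, s i * p i * d i - (∑ i, s i * p i) * ∑ i, p i * d i ≤ Real.sqrt (∑ i, d i ^ 2) := by
  set m := ∑ i, s i * p i with hm
  have hp1 : ∀ i, p i ≤ 1 := fun i =>
    hsum ▸ Finset.single_le_sum (fun j _ => hp j) (Finset.mem_univ i)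
  have hcov : ∑ i, s i * p i * d i - m * ∑ i, p i * d i = ∑ i, (p i * (s i - m)) * d i := by
    rw [Finset.mul_sum, ← Finset.sum_sub_distrib]
    exact Finset.sum_congr rfl fun i _ => by ring
  have hvar : ∑ i, p i * (s i - m) ^ 2 = ∑ i, p i * s i ^ 2 - m ^ 2 := by
    have hexp : ∑ i, p i * (s i - m) ^ 2
        = ∑ i, p i * s i ^ 2 - 2 * m * ∑ i, s i * p i + m ^ 2 * ∑ i, p i := by
      rw [Finset.mul_sum _ _ (2 * m), Finset.mul_sum _ _ (m ^ 2), ← Finset.sum_sub_distrib,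
        ← Finset.sum_add_distrib]
      exact Finset.sum_congr rfl fun i _ => by ring
    rw [hexp, hsum, ← hm]
    ring
  have hle : ∑ i, (p i * (s i - m)) ^ 2 ≤ 1 := calc
    ∑ i, (p i * (s i - m)) ^ 2 ≤ ∑ i, p i * (s i - m) ^ 2 := by
      refine Finset.sum_le_sum fun i _ => ?_
      rw [mul_pow]
      exact mul_le_mul_of_nonneg_right (by nlinarith [hp i, hp1 i]) (sq_nonneg _)
    _ ≤ ∑ i, p i * s i ^ 2 := by rw [hvar]; linarith [sq_nonneg m]
    _ ≤ ∑ i, p i := Finset.sum_le_sum fun i _ => mul_le_of_le_one_right (hp i) (hs i)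
    _ = 1 := hsum
  rw [hcov]
  refine Real.le_sqrt_of_sq_le ((Finset.sum_mul_sq_le_sq_mul_sq _ _ _).trans ?_)
  exact mul_le_of_le_one_left (Finset.sum_nonneg fun i _ => sq_nonneg _) hle

theorem softmax_nonneg {C : ℕ} (z : Fin C → ℝ) (c : Fin C) : 0 ≤ softmax z c := by
  unfold softmax
  positivity

theorem sum_exp_pos {C : ℕ} [NeZero C] (z : Fin C → ℝ) : 0 < ∑ k, Real.exp (z k) :=
  Finset.sum_pos (fun _ _ => Real.exp_pos _) Finset.univ_nonempty

theorem sum_softmax {C : ℕ} [NeZero C] (z : Fin C → ℝ) : ∑ c, softmax z c = 1 := by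
  simp only [softmax]
  rw [← Finset.sum_div, div_self (sum_exp_pos z).ne']

/-- The derivative of a coordinate of softmax along the line `t ↦ b + t • d`. -/
theorem hasDerivAt_softmax_line {C : ℕ} [NeZero C] (b d : Fin C → ℝ) (c : Fin C) (t : ℝ) :
    HasDerivAt (fun u : ℝ => softmax (fun k => b k + u * d k) c)
      (softmax (fun k => b k + t * d k) c *
        (d c - ∑ k, softmax (fun k => b k + t * d k) k * d k)) t := by
  have hexp : ∀ k, HasDerivAt (fun u : ℝ => Real.exp (b k + u * d k))
      (Real.exp (b k + t * d k) * d k) t := fun k => by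
    simpa using (((hasDerivAt_id t).mul_const (d k)).const_add (b k)).exp
  have hpos := sum_exp_pos fun k => b k + t * d k
  have hsum : HasDerivAt (fun u : ℝ => ∑ k, Real.exp (b k + u * d k))
      (∑ k, Real.exp (b k + t * d k) * d k) t := HasDerivAt.fun_sum fun k _ => hexp k
  refine ((hexp c).fun_div hsum hpos.ne').congr_deriv ?_
  simp only [softmax, div_mul_eq_mul_div]
  rw [← Finset.sum_div]
  field_simp

/-- **Softmax is 1-Lipschitz from the ℓ2 norm to the ℓ1 norm:**
`∑ c, |softmax a c − softmax b c| ≤ ‖a − b‖₂`. -/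
theorem softmax_one_lipschitz_l2_to_l1 (C : ℕ) (a b : Fin C → ℝ) :
    ∑ c, |softmax a c - softmax b c| ≤ Real.sqrt (∑ c, (a c - b c) ^ 2) := by
  rcases Nat.eq_zero_or_pos C with rfl | hC
  · simp
  have : NeZero C := ⟨hC.ne'⟩
  set s : Fin C → ℝ := fun c => if 0 ≤ softmax a c - softmax b c then 1 else -1 with hs
  have hs_sq : ∀ c, s c ^ 2 ≤ 1 := fun c => by
    simp only [hs]
    split_ifs <;> norm_num
  have habs : ∀ c, |softmax a c - softmax b c| = s c * (softmax a c - softmax b c) := fun c => by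
    simp only [hs]
    split_ifs with h
    · rw [abs_of_nonneg h, one_mul]
    · rw [abs_of_neg (not_le.mp h), neg_one_mul]
  set d : Fin C → ℝ := fun c => a c - b c with hd
  set p : ℝ → Fin C → ℝ := fun t => softmax fun k => b k + t * d k with hp
  have hderiv : ∀ t, HasDerivAt (fun u => ∑ c, s c * p u c)
      (∑ c, s c * (p t c * (d c - ∑ k, p t k * d k))) t := fun t =>
    HasDerivAt.fun_sum fun c _ => (hasDerivAt_softmax_line b d c t).const_mul (s c)
  obtain ⟨t, -, ht⟩ := exists_hasDerivAt_eq_slope (fun u => ∑ c, s c * p u c) _ zero_lt_one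
    (fun u _ => (hderiv u).continuousAt.continuousWithinAt) (fun u _ => hderiv u)
  have hp0 : p 0 = softmax b := by simp [hp]
  have hp1 : p 1 = softmax a := by simp [hp, hd]
  calc ∑ c, |softmax a c - softmax b c|
      = ∑ c, s c * (p t c * (d c - ∑ k, p t k * d k)) := by
        rw [ht, hp0, hp1, sub_zero, div_one, ← Finset.sum_sub_distrib]
        exact Finset.sum_congr rfl fun c _ => by rw [habs, mul_sub]
    _ = ∑ c, s c * p t c * d c - (∑ c, s c * p t c) * ∑ k, p t k * d k := by
        rw [Finset.sum_mul, ← Finset.sum_sub_distrib]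
        exact Finset.sum_congr rfl fun c _ => by ring
    _ ≤ Real.sqrt (∑ c, d c ^ 2) :=
        covariance_le_sqrt_sum_sq _ _ _ (softmax_nonneg _) (sum_softmax _) hs_sq
end

section
/- (Row similarity bound, step (iii) of the Grouping Effect theorem for GCN.) Let A ∈ {0,1}^{N×N} be a symmetric binary adjacency matrix with degrees d_v = Σ_u A_{vu} satisfying d_v ≥ d_min for all v, for some real d_min > 0. Define the normalized adjacency matrix à by Ã_{uv} = A_{uv} / √(d_u d_v). Then for all nodes i, j: ‖Ã_i − Ã_j‖_1 ≤ (2 N^{3/2} / d_min²) · ‖A_i − A_j‖_2, where Ã_i, A_i denote the i-th rows, ‖·‖_1 the sum of absolute entries and ‖·‖_2 the Euclidean norm. -/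
open Matrix

/-- The Euclidean (ℓ2) norm of a vector in `ℝ^d`. -/
noncomputable def l2norm {d : ℕ} (x : Fin d → ℝ) : ℝ :=
  Real.sqrt (∑ i, (x i) ^ 2)

/-- The ℓ1 norm of a vector in `ℝ^d`. -/
def l1norm {d : ℕ} (x : Fin d → ℝ) : ℝ :=
  ∑ i, |x i|

/-- The inverse square root is Lipschitz away from zero, uniformly in a common factor `c ≥ m`. -/
lemma abs_inv_sqrt_mul_sub_inv_sqrt_mul_le {m a b c : ℝ} (hm : 0 < m) (ha : m ≤ a) (hb : m ≤ b)
    (hc : m ≤ c) : |1 / √(a * c) - 1 / √(b * c)| ≤ |a - b| / m ^ 2 := by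
  have hp : m ≤ √(a * c) := Real.le_sqrt_of_sq_le (by nlinarith)
  have hq : m ≤ √(b * c) := Real.le_sqrt_of_sq_le (by nlinarith)
  have hp2 : √(a * c) ^ 2 = a * c := Real.sq_sqrt (by nlinarith)
  have hq2 : √(b * c) ^ 2 = b * c := Real.sq_sqrt (by nlinarith)
  set p := √(a * c)
  set q := √(b * c)
  have hp0 : 0 < p := hm.trans_le hp
  have hq0 : 0 < q := hm.trans_le hq
  have hc0 : 0 < c := hm.trans_le hc
  have hpq : c * m ≤ p * q := by
    refine le_of_pow_le_pow_left₀ two_ne_zero (by positivity) ?_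
    have hab : m * m ≤ a * b := mul_le_mul ha hb hm.le (hm.le.trans ha)
    calc (c * m) ^ 2 = c ^ 2 * (m * m) := by ring
      _ ≤ c ^ 2 * (a * b) := by gcongr
      _ = (p * q) ^ 2 := by rw [mul_pow, hp2, hq2]; ring
  have hdiff : |p - q| * (p + q) = |a - b| * c := by
    rw [← abs_of_pos (add_pos hp0 hq0), ← abs_mul, ← abs_of_pos hc0, ← abs_mul]
    congr 1
    linear_combination hp2 - hq2
  have heq : |1 / p - 1 / q| = |p - q| / (p * q) := by
    rw [div_sub_div _ _ hp0.ne' hq0.ne', abs_div, abs_of_pos (mul_pos hp0 hq0), one_mul, mul_one,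
      abs_sub_comm]
  rw [heq, div_le_div_iff₀ (by positivity) (by positivity)]
  calc |p - q| * m ^ 2 = |p - q| * m * m := by ring
    _ ≤ |p - q| * (p + q) * m := by gcongr; linarith
    _ = |a - b| * (c * m) := by rw [hdiff]; ring
    _ ≤ |a - b| * (p * q) := by gcongr

/-- Cauchy–Schwarz comparison of the ℓ1 and ℓ2 norms. -/
lemma l1norm_le_sqrt_mul_l2norm {d : ℕ} (x : Fin d → ℝ) : l1norm x ≤ √d * l2norm x := by
  unfold l1norm l2norm
  rw [← Real.sqrt_mul (Nat.cast_nonneg d)]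
  refine Real.le_sqrt_of_sq_le ?_
  simpa using sq_sum_le_card_mul_sum_sq (s := Finset.univ) (f := fun i => |x i|)

/-- **Row similarity bound** (step (iii) of the Grouping Effect theorem for GCN).
For a symmetric binary adjacency matrix `A` with all degrees `d_v = ∑ u, A v u ≥ d_min > 0`
and its symmetric normalization `Ã u v = A u v / √(d_u d_v)`, one has
`‖Ã i − Ã j‖₁ ≤ (2 N^{3/2} / d_min²) · ‖A i − A j‖₂`. -/
theorem normalized_adjacency_row_similarity_bound (N : ℕ)
    (A : Matrix (Fin N) (Fin N) ℝ)
    (hbin : ∀ i j, A i j = 0 ∨ A i j = 1)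
    (hsymm : ∀ i j, A i j = A j i)
    (dmin : ℝ) (hdmin : 0 < dmin)
    (hdeg : ∀ v, dmin ≤ ∑ u, A v u)
    (Atil : Matrix (Fin N) (Fin N) ℝ)
    (hAtil : ∀ u v, Atil u v = A u v / Real.sqrt ((∑ w, A u w) * (∑ w, A v w)))
    (i j : Fin N) :
    l1norm (Atil i - Atil j) ≤
      (2 * (N : ℝ) ^ ((3 : ℝ) / 2) / dmin ^ 2) * l2norm (A i - A j) := by
  have hA0 : ∀ u v, 0 ≤ A u v := fun u v => by rcases hbin u v with h | h <;> simp [h]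
  have hA1 : ∀ u v, A u v ≤ 1 := fun u v => by rcases hbin u v with h | h <;> simp [h]
  have hmN : dmin ≤ N := by
    refine (hdeg i).trans ((Finset.sum_le_sum fun u _ => hA1 i u).trans ?_)
    simp
  set S := l1norm (A i - A j) with hS
  have hS0 : 0 ≤ S := Finset.sum_nonneg fun _ _ => abs_nonneg _
  have hdegS : |(∑ w, A i w) - ∑ w, A j w| ≤ S := by
    rw [← Finset.sum_sub_distrib]
    exact Finset.abs_sum_le_sum_abs _ _
  have hterm : ∀ k, |(Atil i - Atil j) k| ≤ |(A i - A j) k| / dmin + S / dmin ^ 2 := by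
    intro k
    simp only [Pi.sub_apply, hAtil]
    have hlip := (abs_inv_sqrt_mul_sub_inv_sqrt_mul_le hdmin (hdeg i) (hdeg j) (hdeg k)).trans
      (div_le_div_of_nonneg_right hdegS (sq_nonneg dmin))
    have hp : dmin ≤ √((∑ w, A i w) * ∑ w, A k w) :=
      Real.le_sqrt_of_sq_le (by nlinarith [hdeg i, hdeg k])
    set p := √((∑ w, A i w) * ∑ w, A k w)
    set q := √((∑ w, A j w) * ∑ w, A k w)
    have hp0 : 0 < p := hdmin.trans_le hp
    calc |A i k / p - A j k / q| = |(A i k - A j k) / p + A j k * (1 / p - 1 / q)| := by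
          congr 1; ring
      _ ≤ |(A i k - A j k) / p| + |A j k * (1 / p - 1 / q)| := abs_add_le _ _
      _ = |A i k - A j k| / p + A j k * |1 / p - 1 / q| := by
          rw [abs_div, abs_mul, abs_of_pos hp0, abs_of_nonneg (hA0 j k)]
      _ ≤ |A i k - A j k| / dmin + 1 * (S / dmin ^ 2) := by
          gcongr
          exact hA1 j k
      _ = _ := by rw [one_mul]
  have hpow : (N : ℝ) ^ ((3 : ℝ) / 2) = N * √N := by
    rw [Real.sqrt_eq_rpow, show (3 : ℝ) / 2 = 1 + 1 / 2 by norm_num,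
      Real.rpow_add (hdmin.trans_le hmN), Real.rpow_one]
  calc l1norm (Atil i - Atil j) ≤ ∑ k, (|(A i - A j) k| / dmin + S / dmin ^ 2) :=
        Finset.sum_le_sum fun k _ => hterm k
    _ = S / dmin + N * (S / dmin ^ 2) := by
        rw [Finset.sum_add_distrib, ← Finset.sum_div, hS, l1norm]
        simp
    _ = dmin * (S / dmin ^ 2) + N * (S / dmin ^ 2) := by
        congr 1; field_simp
    _ ≤ N * (S / dmin ^ 2) + N * (S / dmin ^ 2) := by gcongr
    _ = 2 * N / dmin ^ 2 * S := by ring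
    _ ≤ 2 * N / dmin ^ 2 * (√N * l2norm (A i - A j)) := by
        gcongr
        exact l1norm_le_sqrt_mul_l2norm _
    _ = _ := by rw [hpow]; ring
end

section
/- (Grouping Effect of GCN, explicit-constant form.) Let A ∈ {0,1}^{N×N} be a symmetric binary adjacency matrix with all degrees d_v = Σ_u A_{vu} ≥ d_min > 0, and let à be the normalized adjacency matrix Ã_{uv} = A_{uv}/√(d_u d_v). Consider an L-layer GCN (L ≥ 1) defined by H^{(0)} = X ∈ ℝ^{N×d_0} and H^{(ℓ+1)} = σ_ℓ(à H^{(ℓ)} W^{(ℓ)}) for ℓ = 0, …, L−1, where each σ_ℓ : ℝ → ℝ is 1-Lipschitz and applied entrywise, and each W^{(ℓ)} is a weight matrix. Let the class probabilities of node i be p_i = softmax(W_{cls}ᵀ H_i^{(L)}) ∈ ℝ^C. Then for all nodes i, j and every class c: |(p_i)_c − (p_j)_c| ≤ ‖W_{cls}‖_op · ‖W^{(L−1)}‖_op · (2 N^{3/2} / d_min²) · ‖A_i − A_j‖_2 · max_v ‖H_v^{(L−1)}‖_2. In particular, nodes with identical adjacency rows receive identical class probabilities. -/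
open Matrix

/-- The ℓ2→ℓ2 operator norm of a real matrix `M`, i.e. the operator norm of the
linear map `x ↦ M.mulVec x` between Euclidean spaces. -/
noncomputable def opNorm {m n : ℕ} (M : Matrix (Fin m) (Fin n) ℝ) : ℝ :=
  ‖LinearMap.toContinuousLinearMap (Matrix.toEuclideanLin M)‖

theorem l2norm_eq_norm_toLp {d : ℕ} (x : Fin d → ℝ) :
    l2norm x = ‖(WithLp.toLp 2 x : EuclideanSpace ℝ (Fin d))‖ := by
  simp [l2norm, EuclideanSpace.norm_eq]

theorem l2norm_nonneg {d : ℕ} (x : Fin d → ℝ) : 0 ≤ l2norm x :=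
  Real.sqrt_nonneg _

theorem abs_apply_le_l2norm {d : ℕ} (x : Fin d → ℝ) (i : Fin d) : |x i| ≤ l2norm x :=
  Real.abs_le_sqrt (Finset.single_le_sum (f := fun i => x i ^ 2)
    (fun _ _ => sq_nonneg _) (Finset.mem_univ i))

theorem l2norm_le_of_abs_le {d : ℕ} {x y : Fin d → ℝ} (h : ∀ i, |x i| ≤ |y i|) :
    l2norm x ≤ l2norm y :=
  Real.sqrt_le_sqrt (Finset.sum_le_sum fun i _ => sq_le_sq.mpr (h i))

theorem sum_abs_le_sqrt_mul_l2norm {d : ℕ} (x : Fin d → ℝ) :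
    ∑ i, |x i| ≤ √(d : ℝ) * l2norm x := by
  rw [l2norm, ← Real.sqrt_mul (Nat.cast_nonneg d)]
  apply Real.le_sqrt_of_sq_le
  simpa using sq_sum_le_card_mul_sum_sq (s := Finset.univ) (f := fun i => |x i|)

theorem opNorm_nonneg {m n : ℕ} (M : Matrix (Fin m) (Fin n) ℝ) : 0 ≤ opNorm M :=
  norm_nonneg _

theorem l2norm_mulVec_le {m n : ℕ} (M : Matrix (Fin m) (Fin n) ℝ) (x : Fin n → ℝ) :
    l2norm (M *ᵥ x) ≤ opNorm M * l2norm x := by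
  rw [l2norm_eq_norm_toLp, l2norm_eq_norm_toLp]
  exact (LinearMap.toContinuousLinearMap (Matrix.toEuclideanLin M)).le_opNorm (WithLp.toLp 2 x)

open scoped Matrix.Norms.L2Operator in
theorem opNorm_transpose {m n : ℕ} (M : Matrix (Fin m) (Fin n) ℝ) : opNorm Mᵀ = opNorm M := by
  have h := Matrix.l2_opNorm_conjTranspose M
  rwa [Matrix.conjTranspose_eq_transpose_of_trivial] at h

theorem l2norm_vecMul_le {m n : ℕ} (x : Fin m → ℝ) (M : Matrix (Fin m) (Fin n) ℝ) :
    l2norm (x ᵥ* M) ≤ opNorm M * l2norm x := by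
  rw [← Matrix.mulVec_transpose, ← opNorm_transpose M]
  exact l2norm_mulVec_le _ _

theorem l2norm_vecMul_le_sum_abs_mul_iSup {m n : ℕ} (x : Fin m → ℝ)
    (M : Matrix (Fin m) (Fin n) ℝ) :
    l2norm (x ᵥ* M) ≤ (∑ v, |x v|) * ⨆ v, l2norm (M v) := by
  have hx : (WithLp.toLp 2 (x ᵥ* M) : EuclideanSpace ℝ (Fin n)) =
      ∑ v, x v • (WithLp.toLp 2 (M v) : EuclideanSpace ℝ (Fin n)) := by
    ext k
    simp [Matrix.vecMul, dotProduct]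
  rw [l2norm_eq_norm_toLp, hx, Finset.sum_mul]
  refine (norm_sum_le _ _).trans (Finset.sum_le_sum fun v _ => ?_)
  rw [norm_smul, Real.norm_eq_abs, ← l2norm_eq_norm_toLp]
  exact mul_le_mul_of_nonneg_left
    (le_ciSup (f := fun v => l2norm (M v)) (Set.finite_range _).bddAbove v) (abs_nonneg _)

/-- If `x ≤ r y` and `T ≤ r S`, then the fractions `x / (x + S)` and `y / (y + T)` differ by at
most `1 - 1 / r`. -/
theorem div_add_sub_div_add_le {x y S T r : ℝ} (hx : 0 < x) (hy : 0 < y) (hS : 0 ≤ S)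
    (hT : 0 ≤ T) (hr : 1 ≤ r) (hxy : x ≤ r * y) (hTS : T ≤ r * S) :
    x / (x + S) - y / (y + T) ≤ 1 - r⁻¹ := by
  have hr0 : 0 < r := by linarith
  have h1 : x / (x + S) ≤ r ^ 2 * y / (r ^ 2 * y + T) := by
    rw [div_le_div_iff₀ (by positivity) (by positivity)]
    nlinarith [mul_le_mul hxy hTS hT (by positivity)]
  have h2 : r ^ 2 * y / (r ^ 2 * y + T) - y / (y + T) ≤ 1 - r⁻¹ := by
    have h3 : 1 - r⁻¹ = (r - 1) / r := by field_simp
    rw [h3, div_sub_div _ _ (by positivity) (by positivity),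
      div_le_div_iff₀ (by positivity) hr0]
    have h4 : r * (r + 1) * (y * T) ≤ (r ^ 2 * y + T) * (y + T) := by
      nlinarith [sq_nonneg (r * y - T), mul_nonneg hy.le hT, mul_nonneg hr0.le (mul_nonneg hy.le hT)]
    nlinarith [mul_le_mul_of_nonneg_left h4 (sub_nonneg.mpr hr)]
  linarith

theorem softmax_sub_le {C : ℕ} (z w : Fin C → ℝ) (c : Fin C) :
    softmax z c - softmax w c ≤ l2norm (z - w) := by
  set δ := l2norm (z - w)
  have hb : ∀ k, |z k - w k| ≤ δ := fun k => abs_apply_le_l2norm (z - w) k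
  have hsum : ∀ u : Fin C → ℝ, ∑ k, Real.exp (u k) =
      Real.exp (u c) + ∑ k ∈ Finset.univ.erase c, Real.exp (u k) := fun u =>
    (Finset.add_sum_erase _ (fun k => Real.exp (u k)) (Finset.mem_univ c)).symm
  have h := div_add_sub_div_add_le (r := Real.exp δ) (Real.exp_pos (z c)) (Real.exp_pos (w c))
    (Finset.sum_nonneg fun k (_ : k ∈ Finset.univ.erase c) => (Real.exp_pos (z k)).le)
    (Finset.sum_nonneg fun k (_ : k ∈ Finset.univ.erase c) => (Real.exp_pos (w k)).le)
    (Real.one_le_exp (l2norm_nonneg _))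
    (by
      rw [← Real.exp_add]
      exact Real.exp_le_exp.mpr (by linarith [(abs_le.mp (hb c)).2]))
    (by
      rw [Finset.mul_sum]
      refine Finset.sum_le_sum fun k _ => ?_
      rw [← Real.exp_add]
      exact Real.exp_le_exp.mpr (by linarith [(abs_le.mp (hb k)).1]))
  rw [← hsum, ← hsum, ← Real.exp_neg] at h
  have h' := Real.add_one_le_exp (-δ)
  simp only [softmax]
  linarith

theorem l2norm_sub_comm {d : ℕ} (x y : Fin d → ℝ) : l2norm (x - y) = l2norm (y - x) := by
  simp only [l2norm, Pi.sub_apply, sub_sq_comm]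

theorem abs_softmax_sub_le {C : ℕ} (z w : Fin C → ℝ) (c : Fin C) :
    |softmax z c - softmax w c| ≤ l2norm (z - w) :=
  abs_sub_le_iff.mpr ⟨softmax_sub_le z w c, l2norm_sub_comm z w ▸ softmax_sub_le w z c⟩

/-- The rows of the symmetrically normalized matrix `a_{uv} / √(d_u d_v)` are Lipschitz in
`ℓ1` norm as functions of the rows of `a`; here `a` and `b` are two such rows, with sums `da` and
`db`, and `d` is the vector of degrees. -/
theorem sum_abs_div_sqrt_sub_le {N : ℕ} {a b d : Fin N → ℝ} {dmin da db : ℝ} (hdmin : 0 < dmin)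
    (hb0 : ∀ v, 0 ≤ b v) (hda : da = ∑ v, a v) (hdb : db = ∑ v, b v) (hda' : dmin ≤ da)
    (hdb' : dmin ≤ db) (hd : ∀ v, dmin ≤ d v) :
    ∑ v, |a v / √(da * d v) - b v / √(db * d v)| ≤ 2 / dmin * ∑ v, |a v - b v| := by
  have ha0 : 0 < √da := Real.sqrt_pos.mpr (by linarith)
  have hb0' : 0 < √db := Real.sqrt_pos.mpr (by linarith)
  have hm0 : 0 < √dmin := Real.sqrt_pos.mpr hdmin
  have hma : √dmin ≤ √da := Real.sqrt_le_sqrt hda'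
  have hsa : √da ^ 2 = da := Real.sq_sqrt (by linarith)
  have hsb : √db ^ 2 = db := Real.sq_sqrt (by linarith)
  have hsm : √dmin * √dmin = dmin := Real.mul_self_sqrt hdmin.le
  have hdiff : |da - db| ≤ ∑ v, |a v - b v| := by
    rw [hda, hdb, ← Finset.sum_sub_distrib]
    exact Finset.abs_sum_le_sum_abs _ _
  have hinv : |(√da)⁻¹ - (√db)⁻¹| * db ≤ |da - db| / √dmin := by
    have h1 : |(√da)⁻¹ - (√db)⁻¹| = |√da - √db| / (√da * √db) := by
      rw [inv_sub_inv ha0.ne' hb0'.ne', abs_div, abs_of_pos (mul_pos ha0 hb0'), abs_sub_comm]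
    have h2 : |da - db| = |√da - √db| * (√da + √db) := by
      nth_rewrite 1 [← hsa, ← hsb]
      rw [sq_sub_sq, abs_mul, abs_of_pos (add_pos ha0 hb0'), mul_comm]
    have h3 : |√da - √db| / (√da * √db) * db = |√da - √db| * √db / √da := by
      nth_rewrite 3 [← hsb]
      field_simp
    rw [h1, h2, h3]
    gcongr
    linarith
  have hterm : ∀ v, |a v / √(da * d v) - b v / √(db * d v)| ≤
      (√dmin)⁻¹ * ((√dmin)⁻¹ * |a v - b v| + |(√da)⁻¹ - (√db)⁻¹| * b v) := by
    intro v
    have hv0 : 0 < √(d v) := Real.sqrt_pos.mpr (hdmin.trans_le (hd v))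
    have heq : a v / √(da * d v) - b v / √(db * d v) =
        (√(d v))⁻¹ * ((√da)⁻¹ * (a v - b v) + ((√da)⁻¹ - (√db)⁻¹) * b v) := by
      rw [Real.sqrt_mul (by linarith), Real.sqrt_mul (by linarith)]
      field_simp
      ring
    rw [heq, abs_mul, abs_of_pos (inv_pos.mpr hv0)]
    have h1 : (√(d v))⁻¹ ≤ (√dmin)⁻¹ := inv_anti₀ hm0 (Real.sqrt_le_sqrt (hd v))
    have h2 : (√da)⁻¹ ≤ (√dmin)⁻¹ := inv_anti₀ hm0 hma
    refine mul_le_mul h1 ((abs_add_le _ _).trans ?_) (abs_nonneg _) (inv_pos.mpr hm0).le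
    rw [abs_mul, abs_mul, abs_of_pos (inv_pos.mpr ha0), abs_of_nonneg (hb0 v)]
    gcongr
  refine (Finset.sum_le_sum fun v _ => hterm v).trans ?_
  rw [← Finset.mul_sum, Finset.sum_add_distrib, ← Finset.mul_sum, ← Finset.mul_sum, ← hdb]
  calc (√dmin)⁻¹ * ((√dmin)⁻¹ * ∑ v, |a v - b v| + |(√da)⁻¹ - (√db)⁻¹| * db)
      ≤ (√dmin)⁻¹ * ((√dmin)⁻¹ * ∑ v, |a v - b v| + (∑ v, |a v - b v|) / √dmin) := by
        gcongr
        exact hinv.trans (by gcongr)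
    _ = 2 / (√dmin * √dmin) * ∑ v, |a v - b v| := by
        field_simp
        ring
    _ = 2 / dmin * ∑ v, |a v - b v| := by rw [hsm]

/-- **Grouping Effect of GCN** (explicit-constant form).
For an `L`-layer GCN `H⁽ˡ⁺¹⁾ = σ_ℓ (Ã H⁽ˡ⁾ W⁽ˡ⁾)` on a symmetric binary adjacency matrix
`A` with minimum degree `d_min > 0` and normalized adjacency `Ã`, followed by the softmax
classifier `p_i = softmax (W_clsᵀ H_i⁽ᴸ⁾)`, the class-probability gap between two nodes is
controlled by the Euclidean distance of their adjacency rows; in particular nodes with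
identical adjacency rows receive identical class probabilities. -/
theorem gcn_grouping_effect
    (N C L : ℕ) (hL : 1 ≤ L)
    (A : Matrix (Fin N) (Fin N) ℝ)
    (hbin : ∀ i j, A i j = 0 ∨ A i j = 1)
    (hsymm : ∀ i j, A i j = A j i)
    (dmin : ℝ) (hdmin : 0 < dmin)
    (hdeg : ∀ v, dmin ≤ ∑ u, A v u)
    (Atil : Matrix (Fin N) (Fin N) ℝ)
    (hAtil : ∀ u v, Atil u v = A u v / Real.sqrt ((∑ w, A u w) * (∑ w, A v w)))
    (dim : ℕ → ℕ) (X : Matrix (Fin N) (Fin (dim 0)) ℝ)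
    (W : ∀ ℓ, Matrix (Fin (dim ℓ)) (Fin (dim (ℓ + 1))) ℝ)
    (σ : ℕ → ℝ → ℝ) (hσ : ∀ ℓ, LipschitzWith 1 (σ ℓ))
    (H : ∀ ℓ, Matrix (Fin N) (Fin (dim ℓ)) ℝ)
    (hH0 : H 0 = X)
    (hrec : ∀ ℓ, H (ℓ + 1) = ((Atil * H ℓ) * W ℓ).map (σ ℓ))
    (Wcls : Matrix (Fin (dim L)) (Fin C) ℝ)
    (p : Fin N → Fin C → ℝ)
    (hp : ∀ i, p i = softmax (Wclsᵀ.mulVec (H L i))) :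
    (∀ i j c, |p i c - p j c| ≤
        opNorm Wclsᵀ * opNorm (W (L - 1)) * (2 * (N : ℝ) ^ ((3 : ℝ) / 2) / dmin ^ 2) *
          l2norm (A i - A j) * ⨆ v, l2norm (H (L - 1) v)) ∧
      (∀ i j, (∀ v, A i v = A j v) → p i = p j) := by
  obtain ⟨K, rfl⟩ : ∃ K, L = K + 1 := ⟨L - 1, by omega⟩
  have hbound : ∀ i j c, |p i c - p j c| ≤
      opNorm Wclsᵀ * opNorm (W K) * (2 * (N : ℝ) ^ ((3 : ℝ) / 2) / dmin ^ 2) *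
        l2norm (A i - A j) * ⨆ v, l2norm (H K v) := by
    intro i j c
    have hA0 : ∀ u v, 0 ≤ A u v := fun u v => by rcases hbin u v with h | h <;> simp [h]
    have hA1 : ∀ u v, A u v ≤ 1 := fun u v => by rcases hbin u v with h | h <;> simp [h]
    have hdN : dmin ≤ N := (hdeg i).trans (by
      simpa using Finset.sum_le_sum fun v (_ : v ∈ Finset.univ) => hA1 i v)
    have hN0 : (0 : ℝ) < N := hdmin.trans_le hdN
    have hsup : 0 ≤ ⨆ v, l2norm (H K v) := Real.iSup_nonneg fun v => l2norm_nonneg _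
    have hAtil' : ∑ v, |(Atil i - Atil j) v| ≤
        2 * (N : ℝ) ^ ((3 : ℝ) / 2) / dmin ^ 2 * l2norm (A i - A j) := by
      have h1 : ∑ v, |(Atil i - Atil j) v| ≤ 2 / dmin * ∑ v, |(A i - A j) v| := by
        simp only [Pi.sub_apply, hAtil]
        exact sum_abs_div_sqrt_sub_le hdmin (hA0 j) rfl rfl (hdeg i) (hdeg j) hdeg
      have h2 : (N : ℝ) ^ ((3 : ℝ) / 2) = N * √N := by
        rw [Real.sqrt_eq_rpow, ← Real.rpow_one_add' hN0.le (by norm_num)]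
        norm_num
      have h3 : 2 / dmin * √N ≤ 2 * (N : ℝ) ^ ((3 : ℝ) / 2) / dmin ^ 2 := by
        have h4 : 2 / dmin * √N = 2 * (dmin * √N) / dmin ^ 2 := by field_simp
        rw [h2, h4]
        gcongr
      calc _ ≤ 2 / dmin * (√N * l2norm (A i - A j)) := h1.trans (by
            gcongr
            exact sum_abs_le_sqrt_mul_l2norm _)
        _ ≤ _ := by
            rw [← mul_assoc]
            exact mul_le_mul_of_nonneg_right h3 (l2norm_nonneg _)
    have hH : l2norm (H (K + 1) i - H (K + 1) j) ≤
        l2norm (((Atil i - Atil j) ᵥ* H K) ᵥ* W K) := by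
      refine l2norm_le_of_abs_le fun k => ?_
      have h1 := (hσ K).dist_le_mul ((Atil * H K * W K) i k) ((Atil * H K * W K) j k)
      rw [Matrix.sub_vecMul, Matrix.sub_vecMul, hrec]
      simpa [Real.dist_eq, Matrix.mul_apply_eq_vecMul] using h1
    calc |p i c - p j c|
        ≤ l2norm (Wclsᵀ *ᵥ H (K + 1) i - Wclsᵀ *ᵥ H (K + 1) j) := by
          rw [hp, hp]
          exact abs_softmax_sub_le _ _ c
      _ ≤ opNorm Wclsᵀ * l2norm (H (K + 1) i - H (K + 1) j) := by
          rw [← Matrix.mulVec_sub]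
          exact l2norm_mulVec_le _ _
      _ ≤ opNorm Wclsᵀ * (opNorm (W K) * ((2 * (N : ℝ) ^ ((3 : ℝ) / 2) / dmin ^ 2 *
            l2norm (A i - A j)) * ⨆ v, l2norm (H K v))) := by
          refine mul_le_mul_of_nonneg_left (hH.trans ((l2norm_vecMul_le _ _).trans
            (mul_le_mul_of_nonneg_left ((l2norm_vecMul_le_sum_abs_mul_iSup _ _).trans
              (mul_le_mul_of_nonneg_right hAtil' hsup)) (opNorm_nonneg _)))) (opNorm_nonneg _)
      _ = _ := by ring
  refine ⟨hbound, fun i j hij => ?_⟩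
  have hA : A i - A j = 0 := sub_eq_zero.mpr (funext hij)
  ext c
  have h := hbound i j c
  have h0 : l2norm (0 : Fin N → ℝ) = 0 := by simp [l2norm]
  rw [hA, h0, mul_zero, zero_mul] at h
  exact sub_eq_zero.mp (abs_nonpos_iff.mp h)
end
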